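/- arXiv:1303.3721 — 4 statements merged into one kernel-verified Lean document; each statement's English description precedes it below -/
import Mathlib

section
/- Let 𝔉 be a convex stratification in ℝⁿ (n ≥ 2) with minimum element K₁ and maximum element K₂, K₁ ≠ K₂. Then there exists a map Ω : [w(K₁), w(K₂)] → {nonempty compact convex subsets of ℝⁿ}, strictly increasing with respect to inclusion, such that w(Ω_τ) = τ for every τ, Ω_{w(K₁)} = K₁, Ω_{w(K₂)} = K₂, every member of 𝔉 occurs as some Ω_τ, and {Ω_τ} is a connected quasi convex family. -/
open Set Metric MeasureTheory
open scoped RealInnerProductSpace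

noncomputable section

/-- Support function of a set. -/
def suppFn {n : ℕ} (C : Set (EuclideanSpace ℝ (Fin n))) (x : EuclideanSpace ℝ (Fin n)) : ℝ :=
  sSup ((fun y => ⟪x, y⟫) '' C)

/-- Normal cone of a set `C` at `q`. -/
def normalCone {n : ℕ} (C : Set (EuclideanSpace ℝ (Fin n))) (q : EuclideanSpace ℝ (Fin n)) :
    Set (EuclideanSpace ℝ (Fin n)) :=
  {v | ∀ y ∈ C, ⟪v, y - q⟫ ≤ 0}

/-- Tangent (support) cone of `C` at `q`. -/
def supportCone {n : ℕ} (C : Set (EuclideanSpace ℝ (Fin n))) (q : EuclideanSpace ℝ (Fin n)) :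
    Set (EuclideanSpace ℝ (Fin n)) :=
  closure {v | ∃ s : ℝ, 0 ≤ s ∧ ∃ y ∈ C, v = s • (y - q)}

/-- Cap body: convex hull of `K ∪ {p}`. -/
def capBody {n : ℕ} (K : Set (EuclideanSpace ℝ (Fin n))) (p : EuclideanSpace ℝ (Fin n)) :
    Set (EuclideanSpace ℝ (Fin n)) :=
  convexHull ℝ (K ∪ {p})

/-- Spherical Lebesgue (surface) measure on `ℝⁿ`: the `(n-1)`-dimensional Hausdorff measure. -/
def sphereMeasure (n : ℕ) : Measure (EuclideanSpace ℝ (Fin n)) := μH[(n : ℝ) - 1]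

/-- Total surface measure of the unit sphere in `ℝⁿ`. -/
def sphereArea (n : ℕ) : ℝ :=
  (sphereMeasure n (sphere (0 : EuclideanSpace ℝ (Fin n)) 1)).toReal

/-- Mean width of a set `C ⊆ ℝⁿ`. -/
def meanWidth {n : ℕ} (C : Set (EuclideanSpace ℝ (Fin n))) : ℝ :=
  (2 / sphereArea n) * ∫ θ in sphere (0 : EuclideanSpace ℝ (Fin n)) 1, suppFn C θ ∂(sphereMeasure n)

/-- Self expanding curve on `[a,b]`. -/
def SelfExpanding {n : ℕ} (a b : ℝ) (x : ℝ → EuclideanSpace ℝ (Fin n)) : Prop :=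
  ContinuousOn x (Icc a b) ∧
  ∀ t₁ t₂ t₃, a ≤ t₁ → t₁ ≤ t₂ → t₂ ≤ t₃ → t₃ ≤ b → dist (x t₂) (x t₁) ≤ dist (x t₃) (x t₁)

/-- Quasi convex family on `[a,b]`. -/
def QuasiConvexFamily {n : ℕ} (a b : ℝ) (Ω : ℝ → Set (EuclideanSpace ℝ (Fin n))) : Prop :=
  (∀ t ∈ Icc a b, (Ω t).Nonempty ∧ IsCompact (Ω t) ∧ Convex ℝ (Ω t)) ∧
  (∀ s t, a ≤ s → s < t → t ≤ b → Ω s ⊂ Ω t) ∧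
  (∀ s ∈ Ico a b, ⋂ t ∈ Ioc s b, Ω t = Ω s)

/-- Connectedness of a quasi convex family. -/
def ConnectedFamily {n : ℕ} (a b : ℝ) (Ω : ℝ → Set (EuclideanSpace ℝ (Fin n))) : Prop :=
  ∀ x ∈ Ω b \ intrinsicInterior ℝ (Ω a), ∃ t ∈ Icc a b, x ∈ intrinsicFrontier ℝ (Ω t)

def insE {m : ℕ} (i : Fin (m+1)) (c : ℝ) (y : Fin m → ℝ) : EuclideanSpace ℝ (Fin (m+1)) :=
  WithLp.toLp 2 (Fin.insertNth (α := fun _ => ℝ) i c y)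

lemma insE_contDiff {m : ℕ} (i : Fin (m+1)) (c : ℝ) : ContDiff ℝ 1 (insE (m := m) i c) := by
  rw [contDiff_euclidean]
  intro j
  refine Fin.succAboveCases i ?_ (fun k => ?_) j
  · simp only [insE, Fin.insertNth_apply_same]; fun_prop
  · simp only [insE, Fin.insertNth_apply_succAbove]; fun_prop

lemma insE_ne {m : ℕ} (i : Fin (m+1)) {c : ℝ} (hc : c ≠ 0) (y : Fin m → ℝ) : insE i c y ≠ 0 := by
  intro h
  have := congrArg (fun v : EuclideanSpace ℝ (Fin (m+1)) => v i) h
  simp [insE] at this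
  exact hc this

def nrmE {m : ℕ} (i : Fin (m+1)) (c : ℝ) (y : Fin m → ℝ) : EuclideanSpace ℝ (Fin (m+1)) :=
  ‖insE i c y‖⁻¹ • insE i c y

lemma nrmE_contDiff {m : ℕ} (i : Fin (m+1)) {c : ℝ} (hc : c ≠ 0) :
    ContDiff ℝ 1 (nrmE (m := m) i c) := by
  have h := insE_contDiff (m := m) i c
  exact ((h.norm ℝ (fun y => insE_ne i hc y)).inv
    (fun y => norm_ne_zero_iff.2 (insE_ne i hc y))).smul h

lemma nrmE_finite {m : ℕ} (i : Fin (m+1)) {c : ℝ} (hc : c ≠ 0) :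
    μH[(m:ℝ)] (nrmE i c '' (Icc (-1) 1 : Set (Fin m → ℝ))) < ⊤ := by
  obtain ⟨K, hK⟩ := (nrmE_contDiff (m := m) i hc).contDiffOn.exists_lipschitzOnWith
    (s := Icc (-1) 1) one_ne_zero (convex_Icc _ _) isCompact_Icc
  refine (hK.hausdorffMeasure_image_le (d := (m:ℝ)) (by positivity)).trans_lt ?_
  have := hausdorffMeasure_pi_real (ι := Fin m)
  rw [Fintype.card_fin] at this
  rw [this]
  exact ENNReal.mul_lt_top (ENNReal.rpow_lt_top_of_nonneg (by positivity) (by simp))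
    isCompact_Icc.measure_lt_top

lemma sphere_cover {m : ℕ} (θ : EuclideanSpace ℝ (Fin (m+1)))  (hθ : ‖θ‖ = 1) :
    ∃ i, ∃ c : ℝ, (c = 1 ∨ c = -1) ∧ θ ∈ nrmE i c '' (Icc (-1) 1 : Set (Fin m → ℝ)) := by
  obtain ⟨i, -, hi⟩ := Finset.exists_max_image Finset.univ (fun i => |θ i|) Finset.univ_nonempty
  have hpos : 0 < |θ i| := by
    by_contra h
    have : θ = 0 := by
      ext j
      have := hi j (Finset.mem_univ _)
      have h2 : |θ j| = 0 := le_antisymm (this.trans (not_lt.1 h)) (abs_nonneg _)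
      simpa using h2
    simp [this] at hθ
  have hne : θ i ≠ 0 := abs_pos.1 hpos
  refine ⟨i, θ i / |θ i|, ?_, fun j => θ (i.succAbove j) / |θ i|, ?_, ?_⟩
  · rcases abs_choice (θ i) with h | h <;> rw [h]
    · left; field_simp
    · right; field_simp
  · constructor <;> intro j
    · simp only [Pi.neg_apply, Pi.one_apply]
      rw [le_div_iff₀ hpos]
      have := hi (i.succAbove j) (Finset.mem_univ _)
      have := neg_abs_le (θ (i.succAbove j)); linarith
    · simp only [Pi.one_apply]
      rw [div_le_one hpos]
      exact (le_abs_self _).trans (hi (i.succAbove j) (Finset.mem_univ _))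
  · have : insE i (θ i / |θ i|) (fun j => θ (i.succAbove j) / |θ i|) = |θ i|⁻¹ • θ := by
      ext j
      refine Fin.succAboveCases i ?_ (fun k => ?_) j
      · simp [insE]; ring
      · simp [insE]; ring
    rw [nrmE, this, norm_smul, hθ, smul_smul]
    simp [hne]

lemma sphere_finite_aux (m : ℕ) :
    μH[(m:ℝ)] (sphere (0 : EuclideanSpace ℝ (Fin (m+1))) 1) < ⊤ := by
  have : sphere (0 : EuclideanSpace ℝ (Fin (m+1))) 1 ⊆
      ⋃ i, (nrmE i 1 '' (Icc (-1) 1 : Set (Fin m → ℝ)) ∪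
        nrmE i (-1) '' (Icc (-1) 1 : Set (Fin m → ℝ))) := by
    intro θ hθ
    obtain ⟨i, c, hc, h⟩ := sphere_cover θ (by simpa using hθ)
    rw [mem_iUnion]
    refine ⟨i, ?_⟩
    rcases hc with rfl | rfl
    · exact Or.inl h
    · exact Or.inr h
  refine (measure_mono this).trans_lt ((measure_iUnion_le _).trans_lt ?_)
  rw [tsum_fintype]
  refine ENNReal.sum_lt_top.2 fun i _ => (measure_union_le _ _).trans_lt ?_
  exact ENNReal.add_lt_top.2 ⟨nrmE_finite i one_ne_zero, nrmE_finite i (by norm_num)⟩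

lemma sphere_pos_aux (m : ℕ) (θ₀ : EuclideanSpace ℝ (Fin (m+1))) (h₀ : ‖θ₀‖ = 1)
    (U : Set (EuclideanSpace ℝ (Fin (m+1)))) (hU : IsOpen U) (hθU : θ₀ ∈ U) :
    0 < μH[(m:ℝ)] (U ∩ sphere (0 : EuclideanSpace ℝ (Fin (m+1))) 1) := by
  obtain ⟨i, hi⟩ : ∃ i, θ₀ i ≠ 0 := by
    by_contra! h
    have : θ₀ = 0 := by ext j; simpa using h j
    simp [this] at h₀
  let P : EuclideanSpace ℝ (Fin (m+1)) → (Fin m → ℝ) := fun v j => v (i.succAbove j)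
  have hP : LipschitzWith 1 P := by
    refine LipschitzWith.of_dist_le_mul fun x y => ?_
    rw [dist_pi_le_iff (by positivity)]
    intro j
    simp only [NNReal.coe_one, one_mul, P]
    rw [dist_eq_norm, dist_eq_norm]
    exact PiLp.norm_apply_le (x - y) _
  let ε : ℝ := SignType.sign (θ₀ i)
  let s : (Fin m → ℝ) → EuclideanSpace ℝ (Fin (m+1)) := fun y =>
    WithLp.toLp 2 (Fin.insertNth (α := fun _ => ℝ) i (ε * √(1 - ∑ j, y j ^ 2)) y)
  have hsc : Continuous s := by
    refine (PiLp.continuous_toLp 2 _).comp (continuous_pi fun j => ?_)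
    refine Fin.succAboveCases i ?_ (fun k => ?_) j
    · simp only [Fin.insertNth_apply_same]; fun_prop
    · simp only [Fin.insertNth_apply_succAbove]; fun_prop
  have hε : ε ^ 2 = 1 := by
    rcases lt_or_gt_of_ne hi with h | h <;> simp [ε, h]
  have hsum : ∀ v : EuclideanSpace ℝ (Fin (m+1)), ‖v‖ = 1 ↔
      v i ^ 2 + ∑ j, (v (i.succAbove j)) ^ 2 = 1 := by
    intro v
    rw [← sq_eq_sq₀ (norm_nonneg _) zero_le_one, EuclideanSpace.norm_sq_eq, Fin.sum_univ_succAbove _ i]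
    simp
  have h1 := (hsum θ₀).1 h₀
  have hi2 : 0 < θ₀ i ^ 2 := by positivity
  have hsP : s (P θ₀) = θ₀ := by
    ext j
    refine Fin.succAboveCases i ?_ (fun k => ?_) j
    · simp only [s, P, Fin.insertNth_apply_same]
      rw [show 1 - ∑ j, θ₀ (i.succAbove j) ^ 2 = θ₀ i ^ 2 by linarith, Real.sqrt_sq_eq_abs]
      exact sign_mul_abs _
    · simp only [s, P, Fin.insertNth_apply_succAbove]
  let V : Set (Fin m → ℝ) := {y | ∑ j, y j ^ 2 < 1} ∩ s ⁻¹' U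
  have hV : IsOpen V := (isOpen_lt (by fun_prop) continuous_const).inter (hU.preimage hsc)
  have hVne : V.Nonempty := ⟨P θ₀, by simp only [mem_ofPred_eq, P]; linarith, by
    rw [mem_preimage, hsP]; exact hθU⟩
  have hVsub : V ⊆ P '' (U ∩ sphere (0 : EuclideanSpace ℝ (Fin (m+1))) 1) := by
    rintro y ⟨hy, hyU⟩
    refine ⟨s y, ⟨hyU, ?_⟩, ?_⟩
    · rw [mem_sphere_zero_iff_norm, hsum]
      simp only [s, Fin.insertNth_apply_same, Fin.insertNth_apply_succAbove]
      rw [mul_pow, hε, Real.sq_sqrt (by simp only [mem_ofPred_eq] at hy; linarith)]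
      ring
    · ext j; simp [P, s]
  have hvol := hausdorffMeasure_pi_real (ι := Fin m)
  rw [Fintype.card_fin] at hvol
  have h2 := hP.hausdorffMeasure_image_le (d := (m:ℝ)) (by positivity)
    (U ∩ sphere (0 : EuclideanSpace ℝ (Fin (m+1))) 1)
  rw [hvol] at h2
  simp only [ENNReal.coe_one, ENNReal.one_rpow, one_mul] at h2
  exact (hV.measure_pos volume hVne).trans_le ((measure_mono hVsub).trans h2)

lemma mem_of_mem_intrinsicInterior_closure {E : Type*} [NormedAddCommGroup E] [NormedSpace ℝ E]
    [FiniteDimensional ℝ E] {U : Set E} (hU : Convex ℝ U) (hne : U.Nonempty) {x : E}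
    (hx : x ∈ intrinsicInterior ℝ (closure U)) : x ∈ U := by
  have := hne.coe_sort
  obtain ⟨p, hp⟩ := hne
  let S := affineSpan ℝ U
  let p' : S := ⟨p, subset_affineSpan _ _ hp⟩
  let φ : S.direction →ᵃⁱ[ℝ] E :=
    S.subtypeₐᵢ.comp (AffineIsometryEquiv.constVSub ℝ p').symm.toAffineIsometry
  let W : Set S.direction := φ ⁻¹' U
  have hφW : φ '' W = U := by
    apply image_preimage_eq_of_subset
    intro y hy
    refine ⟨(AffineIsometryEquiv.constVSub ℝ p') ⟨y, subset_affineSpan _ _ hy⟩, ?_⟩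
    simp [φ]
  have hWc : Convex ℝ W := hU.affine_preimage φ.toAffineMap
  have hspan : affineSpan ℝ W = ⊤ := by
    have h : (affineSpan ℝ W).map φ.toAffineMap = S := by
      rw [AffineSubspace.map_span]
      change affineSpan ℝ (φ '' W) = S
      rw [hφW]
    refine eq_top_iff.2 fun v _ => ?_
    have hv : φ v ∈ (affineSpan ℝ W).map φ.toAffineMap := by
      rw [h]; exact ((AffineIsometryEquiv.constVSub ℝ p').symm v).2
    obtain ⟨w, hw, hwv⟩ := hv
    have : w = v := φ.injective hwv
    exact this ▸ hw
  have hWint : (interior W).Nonempty := hWc.interior_nonempty_iff_affineSpan_eq_top.2 hspan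
  have hcl : closure U = φ '' closure W := by
    rw [← φ.isometry.isClosedEmbedding.closure_image_eq, hφW]
  rw [hcl, AffineIsometry.intrinsicInterior_image] at hx
  obtain ⟨v, hv, rfl⟩ := hx
  have hspan2 : affineSpan ℝ (closure W) = ⊤ :=
    top_le_iff.1 (hspan ▸ affineSpan_mono ℝ subset_closure)
  have hv2 : v ∈ interior (closure W) := by
    obtain ⟨y, hy, rfl⟩ := hv
    have ho : IsOpen ((affineSpan ℝ (closure W) : AffineSubspace ℝ S.direction) :
        Set S.direction) := by
      rw [hspan2]; exact isOpen_univ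
    have h1 := ho.isOpenMap_subtype_val.image_interior_subset
      ((↑) ⁻¹' closure W : Set (affineSpan ℝ (closure W)))
    have h2 := h1 (mem_image_of_mem _ hy)
    exact interior_mono (image_preimage_subset _ _) h2
  rw [hWc.interior_closure_eq_interior_of_nonempty_interior hWint] at hv2
  exact interior_subset (s := W) hv2

section Width
variable {n : ℕ}

lemma sphere_finite (hn : 2 ≤ n) :
    sphereMeasure n (sphere (0 : EuclideanSpace ℝ (Fin n)) 1) < ⊤ := by
  obtain ⟨m, rfl⟩ : ∃ m, n = m + 1 := ⟨n - 1, by omega⟩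
  have := sphere_finite_aux m
  simpa [sphereMeasure] using this

lemma sphere_pos (hn : 2 ≤ n) (θ₀ : EuclideanSpace ℝ (Fin n)) (h₀ : ‖θ₀‖ = 1)
    (U : Set (EuclideanSpace ℝ (Fin n))) (hU : IsOpen U) (hθU : θ₀ ∈ U) :
    0 < sphereMeasure n (U ∩ sphere (0 : EuclideanSpace ℝ (Fin n)) 1) := by
  obtain ⟨m, rfl⟩ : ∃ m, n = m + 1 := ⟨n - 1, by omega⟩
  have := sphere_pos_aux m θ₀ h₀ U hU hθU
  simpa [sphereMeasure] using this

lemma sphereArea_pos (hn : 2 ≤ n) : 0 < sphereArea n := by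
  have := sphere_pos hn (EuclideanSpace.single ⟨0, by omega⟩ 1) (by simp) univ isOpen_univ trivial
  rw [univ_inter] at this
  exact ENNReal.toReal_pos this.ne' (sphere_finite hn).ne

lemma suppFn_cont {C : Set (EuclideanSpace ℝ (Fin n))} (hC : IsCompact C) :
    Continuous (suppFn C) := by
  unfold suppFn
  exact hC.continuous_sSup (f := fun x y => ⟪x, y⟫) (by fun_prop)

lemma suppFn_bdd {C : Set (EuclideanSpace ℝ (Fin n))} (hC : IsCompact C)
    (x : EuclideanSpace ℝ (Fin n)) : BddAbove ((fun y => ⟪x, y⟫) '' C) :=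
  (hC.image (by fun_prop)).bddAbove

lemma le_suppFn {C : Set (EuclideanSpace ℝ (Fin n))} (hC : IsCompact C)
    (x : EuclideanSpace ℝ (Fin n)) {y} (hy : y ∈ C) : ⟪x, y⟫ ≤ suppFn C x :=
  le_csSup (suppFn_bdd hC x) (mem_image_of_mem _ hy)

lemma suppFn_le {C : Set (EuclideanSpace ℝ (Fin n))} (hC : C.Nonempty)
    {x : EuclideanSpace ℝ (Fin n)} {a : ℝ} (h : ∀ y ∈ C, ⟪x, y⟫ ≤ a) : suppFn C x ≤ a := by
  refine csSup_le (hC.image _) ?_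
  rintro _ ⟨y, hy, rfl⟩
  exact h y hy

lemma suppFn_integrable (hn : 2 ≤ n) {C : Set (EuclideanSpace ℝ (Fin n))} (hC : IsCompact C) :
    IntegrableOn (suppFn C) (sphere (0 : EuclideanSpace ℝ (Fin n)) 1) (sphereMeasure n) := by
  have hf : IsFiniteMeasure ((sphereMeasure n).restrict
      (sphere (0 : EuclideanSpace ℝ (Fin n)) 1)) := ⟨by simpa using sphere_finite hn⟩
  obtain ⟨B, hB⟩ := (isCompact_sphere (0 : EuclideanSpace ℝ (Fin n)) 1).exists_bound_of_continuousOn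
    (suppFn_cont hC).continuousOn
  refine Integrable.of_bound (C := B) (suppFn_cont hC).aestronglyMeasurable ?_
  exact (ae_restrict_iff' isClosed_sphere.measurableSet).2 (Filter.Eventually.of_forall hB)

lemma meanWidth_le_add (hn : 2 ≤ n) {C D : Set (EuclideanSpace ℝ (Fin n))} (hC : IsCompact C)
    (hCn : C.Nonempty) (hD : IsCompact D) {ε : ℝ} (h : ∀ x ∈ C, ∃ y ∈ D, dist x y ≤ ε) :
    meanWidth C ≤ meanWidth D + 2 * ε := by
  have hA := sphereArea_pos hn
  have h1 : ∫ θ in sphere (0 : EuclideanSpace ℝ (Fin n)) 1, suppFn C θ ∂(sphereMeasure n) ≤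
      ∫ θ in sphere (0 : EuclideanSpace ℝ (Fin n)) 1, (suppFn D θ + ε) ∂(sphereMeasure n) := by
    refine setIntegral_mono_on (suppFn_integrable hn hC) ((suppFn_integrable hn hD).add
      (integrableOn_const (sphere_finite hn).ne)) isClosed_sphere.measurableSet fun θ hθ => ?_
    refine suppFn_le hCn fun x hx => ?_
    obtain ⟨y, hy, hxy⟩ := h x hx
    have h2 := le_suppFn hD θ hy
    have h3 : ⟪θ, x - y⟫ ≤ ‖θ‖ * ‖x - y‖ := real_inner_le_norm _ _
    rw [mem_sphere_zero_iff_norm.1 hθ, inner_sub_right, one_mul, ← dist_eq_norm] at h3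
    linarith
  rw [integral_add (suppFn_integrable hn hD) (integrableOn_const (sphere_finite hn).ne),
    setIntegral_const] at h1
  have h4 : (sphereMeasure n).real (sphere (0 : EuclideanSpace ℝ (Fin n)) 1) = sphereArea n := rfl
  rw [h4, smul_eq_mul] at h1
  unfold meanWidth
  calc _ ≤ _ := mul_le_mul_of_nonneg_left h1 (by positivity)
    _ = _ := by field_simp

lemma meanWidth_mono (hn : 2 ≤ n) {C D : Set (EuclideanSpace ℝ (Fin n))} (hC : IsCompact C)
    (hCn : C.Nonempty) (hD : IsCompact D) (h : C ⊆ D) : meanWidth C ≤ meanWidth D := by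
  simpa using meanWidth_le_add hn hC hCn hD (ε := 0) fun x hx => ⟨x, h hx, by simp⟩

lemma exists_sep {C : Set (EuclideanSpace ℝ (Fin n))} (hC : IsCompact C) (hv : Convex ℝ C)
    {x : EuclideanSpace ℝ (Fin n)} (hx : x ∉ C) :
    ∃ v : EuclideanSpace ℝ (Fin n), ∃ u : ℝ, (∀ y ∈ C, ⟪v, y⟫ < u) ∧ u < ⟪v, x⟫ := by
  obtain ⟨f, u, h1, h2⟩ := geometric_hahn_banach_closed_point hv hC.isClosed hx
  refine ⟨(InnerProductSpace.toDual ℝ _).symm f, u, ?_, ?_⟩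
  · simpa using h1
  · simpa using h2

lemma meanWidth_strict (hn : 2 ≤ n) {C D : Set (EuclideanSpace ℝ (Fin n))} (hC : IsCompact C)
    (hCn : C.Nonempty) (hv : Convex ℝ C) (hD : IsCompact D) (h : C ⊂ D) :
    meanWidth C < meanWidth D := by
  have hA := sphereArea_pos hn
  obtain ⟨x, hxD, hxC⟩ := exists_of_ssubset h
  obtain ⟨v, u, h1, h2⟩ := exists_sep hC hv hxC
  have hv0 : v ≠ 0 := by
    rintro rfl
    obtain ⟨y, hy⟩ := hCn
    have := h1 y hy
    simp at this h2
    linarith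
  have hvn : 0 < ‖v‖ := norm_pos_iff.2 hv0
  let θ := ‖v‖⁻¹ • v
  have hθ : ‖θ‖ = 1 := by simp [θ, norm_smul, hvn.ne']
  have hlt : suppFn C θ < suppFn D θ := by
    have ha : suppFn C θ ≤ ‖v‖⁻¹ * u := suppFn_le hCn fun y hy => by
      simp only [θ, real_inner_smul_left]
      exact mul_le_mul_of_nonneg_left (h1 y hy).le (by positivity)
    have hb : ‖v‖⁻¹ * u < ⟪θ, x⟫ := by
      simp only [θ, real_inner_smul_left]
      exact mul_lt_mul_of_pos_left h2 (by positivity)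
    exact ha.trans_lt (hb.trans_le (le_suppFn hD θ hxD))
  have hpos : 0 < ∫ θ in sphere (0 : EuclideanSpace ℝ (Fin n)) 1, (suppFn D θ - suppFn C θ)
      ∂(sphereMeasure n) := by
    refine (integral_pos_iff_support_of_nonneg (f := fun θ => suppFn D θ - suppFn C θ) ?_
      ((suppFn_integrable hn hD).sub (suppFn_integrable hn hC))).2 ?_
    swap
    · rw [Measure.restrict_apply' isClosed_sphere.measurableSet]
      refine (sphere_pos hn θ hθ {θ | suppFn C θ < suppFn D θ}
        (isOpen_lt (suppFn_cont hC) (suppFn_cont hD)) hlt).trans_le (measure_mono ?_)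
      rintro z ⟨hz, hz'⟩
      exact ⟨(sub_pos.2 hz).ne', hz'⟩
    · intro z
      exact sub_nonneg.2 (suppFn_le hCn fun y hy => le_suppFn hD z (h.1 hy))
  rw [integral_sub (suppFn_integrable hn hD) (suppFn_integrable hn hC)] at hpos
  unfold meanWidth
  exact mul_lt_mul_of_pos_left (sub_pos.1 hpos) (by positivity)

/-- convex bodies -/
def IsBody (C : Set (EuclideanSpace ℝ (Fin n))) : Prop := C.Nonempty ∧ IsCompact C ∧ Convex ℝ C

lemma body_eq (hn : 2 ≤ n) {C D : Set (EuclideanSpace ℝ (Fin n))} (hC : IsBody C)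
    (hD : IsBody D) (h : C ⊆ D) (hw : meanWidth D ≤ meanWidth C) : C = D := by
  by_contra hne
  exact (meanWidth_strict hn hC.2.1 hC.1 hC.2.2 hD.2.1 (h.ssubset_of_ne hne)).not_ge hw

/-- closure of the union of a chain of bodies contained in a body -/
lemma body_union {c : Set (Set (EuclideanSpace ℝ (Fin n)))} (hc : ∀ C ∈ c, IsBody C)
    (hch : IsChain (· ⊆ ·) c) (hne : c.Nonempty) {K : Set (EuclideanSpace ℝ (Fin n))}
    (hK : IsBody K) (hcK : ∀ C ∈ c, C ⊆ K) : IsBody (closure (⋃₀ c)) := by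
  refine ⟨?_, ?_, ?_⟩
  · obtain ⟨C, hC⟩ := hne
    obtain ⟨x, hx⟩ := (hc C hC).1
    exact ⟨x, subset_closure ⟨C, hC, hx⟩⟩
  · exact hK.2.1.of_isClosed_subset isClosed_closure
      (closure_minimal (sUnion_subset hcK) hK.2.1.isClosed)
  · exact (hch.directedOn.convex_sUnion fun {C} hC => (hc C hC).2.2).closure

lemma body_union_width (hn : 2 ≤ n) {c : Set (Set (EuclideanSpace ℝ (Fin n)))}
    (hc : ∀ C ∈ c, IsBody C)
    (hch : IsChain (· ⊆ ·) c) (hne : c.Nonempty) {K : Set (EuclideanSpace ℝ (Fin n))}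
    (hK : IsBody K) (hcK : ∀ C ∈ c, C ⊆ K) {τ : ℝ} (hτ : ∀ C ∈ c, meanWidth C ≤ τ) :
    meanWidth (closure (⋃₀ c)) ≤ τ := by
  have hb := body_union hc hch hne hK hcK
  refine le_of_forall_pos_le_add fun ε hε => ?_
  have hne' : Nonempty c := hne.to_subtype
  obtain ⟨C, hC⟩ := hb.2.1.elim_directed_cover (fun C : c => thickening (ε/2) (C : Set _))
    (fun _ => isOpen_thickening) (by
      intro x hx
      obtain ⟨y, ⟨C, hC, hy⟩, hxy⟩ := Metric.mem_closure_iff.1 hx (ε/2) (by positivity)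
      exact mem_iUnion.2 ⟨⟨C, hC⟩, mem_thickening_iff.2 ⟨y, hy, hxy⟩⟩) (by
      intro C D
      rcases hch.total C.2 D.2 with h | h
      · exact ⟨D, thickening_subset_of_subset _ h, subset_rfl⟩
      · exact ⟨C, subset_rfl, thickening_subset_of_subset _ h⟩)
  have := meanWidth_le_add hn hb.2.1 hb.1 (hc C C.2).2.1 (ε := ε/2) fun x hx => by
    obtain ⟨y, hy, hxy⟩ := mem_thickening_iff.1 (hC hx)
    exact ⟨y, hy, hxy.le⟩
  have := hτ C C.2
  linarith

lemma body_inter {c : Set (Set (EuclideanSpace ℝ (Fin n)))} (hc : ∀ C ∈ c, IsBody C)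
    (hne : c.Nonempty) {K : Set (EuclideanSpace ℝ (Fin n))}
    (hK : IsBody K) (hcK : ∀ C ∈ c, K ⊆ C) : IsBody (⋂₀ c) := by
  refine ⟨hK.1.mono (subset_sInter hcK), ?_, convex_sInter fun C hC => (hc C hC).2.2⟩
  obtain ⟨C, hC⟩ := hne
  exact (hc C hC).2.1.of_isClosed_subset (isClosed_sInter fun D hD => (hc D hD).2.1.isClosed)
    (sInter_subset_of_mem hC)

lemma body_inter_width (hn : 2 ≤ n) {c : Set (Set (EuclideanSpace ℝ (Fin n)))}
    (hc : ∀ C ∈ c, IsBody C)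
    (hch : IsChain (· ⊆ ·) c) (hne : c.Nonempty) {K : Set (EuclideanSpace ℝ (Fin n))}
    (hK : IsBody K) (hcK : ∀ C ∈ c, K ⊆ C) {τ : ℝ} (hτ : ∀ C ∈ c, τ ≤ meanWidth C) :
    τ ≤ meanWidth (⋂₀ c) := by
  have hb := body_inter hc hne hK hcK
  refine le_of_forall_pos_le_add fun ε hε => ?_
  have hne' : Nonempty c := hne.to_subtype
  obtain ⟨C, hC⟩ := exists_subset_nhds_of_isCompact' (V := fun C : c => (C : Set _))
    (U := thickening (ε/2) (⋂₀ c)) (by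
      intro C D
      rcases hch.total C.2 D.2 with h | h
      · exact ⟨C, subset_rfl, h⟩
      · exact ⟨D, h, subset_rfl⟩) (fun C => (hc C C.2).2.1) (fun C => (hc C C.2).2.1.isClosed)
    (by
      intro x hx
      rw [← sInter_eq_iInter] at hx
      exact isOpen_thickening.mem_nhds (self_subset_thickening (by positivity) _ hx))
  have := meanWidth_le_add hn (hc C C.2).2.1 (hc C C.2).1 hb.2.1 (ε := ε/2) fun x hx => by
    obtain ⟨y, hy, hxy⟩ := mem_thickening_iff.1 (hC hx)
    exact ⟨y, hy, hxy.le⟩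
  have := hτ C C.2
  linarith

lemma body_between {A B : Set (EuclideanSpace ℝ (Fin n))} (hA : IsBody A) (hB : IsBody B)
    (h : A ⊂ B) : ∃ C, IsBody C ∧ A ⊂ C ∧ C ⊂ B := by
  obtain ⟨x, hxB, hxA⟩ := exists_of_ssubset h
  obtain ⟨v, u, h1, h2⟩ := exists_sep hA.2.1 hA.2.2 hxA
  obtain ⟨a, ha⟩ := hA.1
  have hua := h1 a ha
  have hcont : Continuous fun y : EuclideanSpace ℝ (Fin n) => ⟪v, y⟫ := by fun_prop
  refine ⟨B ∩ {y | ⟪v, y⟫ ≤ u}, ⟨⟨a, h.1 ha, hua.le⟩,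
    hB.2.1.inter_right (isClosed_le hcont continuous_const), hB.2.2.inter ?_⟩, ?_, ?_⟩
  · exact convex_halfSpace_le (innerSL ℝ v).isLinear u
  · have hsub : A ⊆ B ∩ {y | ⟪v, y⟫ ≤ u} := fun y hy => ⟨h.1 hy, (h1 y hy).le⟩
    refine (ssubset_iff_of_subset hsub).2 ?_
    -- point on the segment at level `u`
    have hd : 0 < ⟪v, x⟫ - ⟪v, a⟫ := by linarith
    let t := (u - ⟪v, a⟫) / (⟪v, x⟫ - ⟪v, a⟫)
    have ht0 : 0 ≤ t := div_nonneg (by linarith) hd.le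
    have ht1 : t ≤ 1 := (div_le_one hd).2 (by linarith)
    have hz : ⟪v, (1 - t) • a + t • x⟫ = u := by
      rw [inner_add_right, real_inner_smul_right, real_inner_smul_right]
      have : t * (⟪v, x⟫ - ⟪v, a⟫) = u - ⟪v, a⟫ := div_mul_cancel₀ _ hd.ne'
      linarith
    refine ⟨(1 - t) • a + t • x, ⟨hB.2.2 (h.1 ha) hxB (by linarith) ht0 (by ring), hz.le⟩, ?_⟩
    intro hmem
    exact (h1 _ hmem).ne hz
  · rw [ssubset_iff_of_subset inter_subset_left]
    exact ⟨x, hxB, fun hx => h2.not_ge hx.2⟩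

end Width

lemma exists_max_chain {n : ℕ} (F : Set (Set (EuclideanSpace ℝ (Fin n))))
    (hF : ∀ Q ∈ F, Q.Nonempty ∧ IsCompact Q ∧ Convex ℝ Q)
    (hchain : ∀ P ∈ F, ∀ Q ∈ F, P ⊆ Q ∨ Q ⊆ P)
    (K₁ K₂ : Set (EuclideanSpace ℝ (Fin n)))
    (hmin : ∀ Q ∈ F, K₁ ⊆ Q) (hmax : ∀ Q ∈ F, Q ⊆ K₂) :
    ∃ M : Set (Set (EuclideanSpace ℝ (Fin n))), F ⊆ M ∧
      (∀ C ∈ M, IsBody C ∧ K₁ ⊆ C ∧ C ⊆ K₂) ∧ IsChain (· ⊆ ·) M ∧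
      (∀ D, IsBody D → K₁ ⊆ D → D ⊆ K₂ → (∀ C ∈ M, D ⊆ C ∨ C ⊆ D) → D ∈ M) := by
  let S : Set (Set (Set (EuclideanSpace ℝ (Fin n)))) :=
    {c | (∀ C ∈ c, IsBody C ∧ K₁ ⊆ C ∧ C ⊆ K₂) ∧ IsChain (· ⊆ ·) c}
  obtain ⟨M, hFM, hM⟩ := zorn_subset_nonempty S (by
    intro c hcS hc _
    refine ⟨⋃₀ c, ⟨?_, ?_⟩, fun s hs => subset_sUnion_of_mem hs⟩
    · rintro C ⟨s, hs, hC⟩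
      exact (hcS hs).1 C hC
    · rintro C ⟨s, hs, hC⟩ D ⟨r, hr, hD⟩ hCD
      rcases hc.total hs hr with h | h
      · exact (hcS hr).2 (h hC) hD hCD
      · exact (hcS hs).2 hC (h hD) hCD) F
    ⟨fun C hC => ⟨hF C hC, hmin C hC, hmax C hC⟩, fun C hC D hD _ => hchain C hC D hD⟩
  refine ⟨M, hFM, hM.prop.1, hM.prop.2, fun D hD h1 h2 h3 => ?_⟩
  have hins : insert D M ∈ S := by
    refine ⟨?_, hM.prop.2.insert fun C hC _ => h3 C hC⟩
    rintro C (rfl | hC)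
    · exact ⟨hD, h1, h2⟩
    · exact hM.prop.1 C hC
  exact hM.le_of_ge hins (subset_insert _ _) (mem_insert _ _)

lemma max_chain_surj {n : ℕ} (hn : 2 ≤ n) {K₁ K₂ : Set (EuclideanSpace ℝ (Fin n))}
    (hb₁ : IsBody K₁) (hb₂ : IsBody K₂)
    (M : Set (Set (EuclideanSpace ℝ (Fin n)))) (hM₁ : K₁ ∈ M) (hM₂ : K₂ ∈ M)
    (hMb : ∀ C ∈ M, IsBody C ∧ K₁ ⊆ C ∧ C ⊆ K₂) (hMch : IsChain (· ⊆ ·) M)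
    (hMmax : ∀ D, IsBody D → K₁ ⊆ D → D ⊆ K₂ → (∀ C ∈ M, D ⊆ C ∨ C ⊆ D) → D ∈ M) :
    ∀ τ ∈ Icc (meanWidth K₁) (meanWidth K₂), ∃ C ∈ M, meanWidth C = τ := by
  intro τ hτ
  let L : Set (Set (EuclideanSpace ℝ (Fin n))) := {C | C ∈ M ∧ meanWidth C ≤ τ}
  let R : Set (Set (EuclideanSpace ℝ (Fin n))) := {C | C ∈ M ∧ τ ≤ meanWidth C}
  have hLM : L ⊆ M := fun C hC => hC.1
  have hRM : R ⊆ M := fun C hC => hC.1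
  have hLne : L.Nonempty := ⟨K₁, hM₁, hτ.1⟩
  have hRne : R.Nonempty := ⟨K₂, hM₂, hτ.2⟩
  have hLb : ∀ C ∈ L, IsBody C := fun C hC => (hMb C hC.1).1
  have hRb : ∀ C ∈ R, IsBody C := fun C hC => (hMb C hC.1).1
  have hLK : ∀ C ∈ L, C ⊆ K₂ := fun C hC => (hMb C hC.1).2.2
  have hRK : ∀ C ∈ R, K₁ ⊆ C := fun C hC => (hMb C hC.1).2.1
  have hLR : ∀ C ∈ L, ∀ D ∈ R, C ⊆ D := by
    intro C hC D hD
    rcases hMch.total hC.1 hD.1 with h | h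
    · exact h
    · exact (body_eq hn (hRb D hD) (hLb C hC) h (hC.2.trans hD.2)).symm.subset
  have hA := body_union hLb (hMch.mono hLM) hLne hb₂ hLK
  have hAw := body_union_width hn hLb (hMch.mono hLM) hLne hb₂ hLK (τ := τ) fun C hC => hC.2
  have hB := body_inter hRb hRne hb₁ hRK
  have hBw := body_inter_width hn hRb (hMch.mono hRM) hRne hb₁ hRK (τ := τ) fun C hC => hC.2
  set A := closure (⋃₀ L)
  set B := ⋂₀ R
  have hLA : ∀ C ∈ L, C ⊆ A := fun C hC => (subset_sUnion_of_mem hC).trans subset_closure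
  have hBR : ∀ C ∈ R, B ⊆ C := fun C hC => sInter_subset_of_mem hC
  have hAB : A ⊆ B := closure_minimal
    (sUnion_subset fun C hC => subset_sInter fun D hD => hLR C hC D hD) hB.2.1.isClosed
  have hmid : ∀ D, IsBody D → A ⊆ D → D ⊆ B → D ∈ M := by
    intro D hD h1 h2
    refine hMmax D hD ((hLA K₁ ⟨hM₁, hτ.1⟩).trans h1) (h2.trans (hBR K₂ ⟨hM₂, hτ.2⟩)) ?_
    intro C hC
    rcases le_total (meanWidth C) τ with h | h
    · exact Or.inr ((hLA C ⟨hC, h⟩).trans h1)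
    · exact Or.inl (h2.trans (hBR C ⟨hC, h⟩))
  by_cases hEq : A = B
  · exact ⟨A, hmid A hA subset_rfl hAB, le_antisymm hAw (hEq ▸ hBw)⟩
  · exfalso
    obtain ⟨C, hC, h1, h2⟩ := body_between hA hB (hAB.ssubset_of_ne hEq)
    have hCM := hmid C hC h1.1 h2.1
    rcases le_total (meanWidth C) τ with h | h
    · exact h1.2 (hLA C ⟨hCM, h⟩)
    · exact h2.2 (hBR C ⟨hCM, h⟩)

/-- completion of a convex stratification into a connected quasi convex
family parameterized by mean width. -/
theorem convexStratification_completion {n : ℕ} (hn : 2 ≤ n)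
    (F : Set (Set (EuclideanSpace ℝ (Fin n))))
    (hF : ∀ Q ∈ F, Q.Nonempty ∧ IsCompact Q ∧ Convex ℝ Q)
    (hchain : ∀ P ∈ F, ∀ Q ∈ F, P ⊆ Q ∨ Q ⊆ P)
    (K₁ K₂ : Set (EuclideanSpace ℝ (Fin n))) (hK₁ : K₁ ∈ F) (hK₂ : K₂ ∈ F)
    (hmin : ∀ Q ∈ F, K₁ ⊆ Q) (hmax : ∀ Q ∈ F, Q ⊆ K₂) (hne : K₁ ≠ K₂) :
    ∃ Ω : ℝ → Set (EuclideanSpace ℝ (Fin n)),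
      QuasiConvexFamily (meanWidth K₁) (meanWidth K₂) Ω ∧
      ConnectedFamily (meanWidth K₁) (meanWidth K₂) Ω ∧
      (∀ τ ∈ Icc (meanWidth K₁) (meanWidth K₂), meanWidth (Ω τ) = τ) ∧
      Ω (meanWidth K₁) = K₁ ∧ Ω (meanWidth K₂) = K₂ ∧
      (∀ Q ∈ F, ∃ τ ∈ Icc (meanWidth K₁) (meanWidth K₂), Ω τ = Q) := by
  have hb₁ : IsBody K₁ := hF K₁ hK₁
  have hb₂ : IsBody K₂ := hF K₂ hK₂
  obtain ⟨M, hFM, hMb, hMch, hMmax⟩ := exists_max_chain F hF hchain K₁ K₂ hmin hmax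
  have hM₁ : K₁ ∈ M := hFM hK₁
  have hM₂ : K₂ ∈ M := hFM hK₂
  have hsurj : ∀ τ ∈ Icc (meanWidth K₁) (meanWidth K₂), ∃ C ∈ M, meanWidth C = τ :=
    max_chain_surj hn hb₁ hb₂ M hM₁ hM₂ hMb hMch hMmax
  have hinj : ∀ C ∈ M, ∀ D ∈ M, meanWidth C = meanWidth D → C = D := by
    intro C hC D hD h
    rcases hMch.total hC hD with hle | hle
    · exact body_eq hn (hMb C hC).1 (hMb D hD).1 hle h.ge
    · exact (body_eq hn (hMb D hD).1 (hMb C hC).1 hle h.le).symm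
  have hsub : ∀ C ∈ M, ∀ D ∈ M, meanWidth C ≤ meanWidth D → C ⊆ D := by
    intro C hC D hD h
    rcases hMch.total hC hD with hle | hle
    · exact hle
    · exact (body_eq hn (hMb D hD).1 (hMb C hC).1 hle h).symm.subset
  choose! Ω hΩM hΩw using hsurj
  have hlt : meanWidth K₁ < meanWidth K₂ :=
    meanWidth_strict hn hb₁.2.1 hb₁.1 hb₁.2.2 hb₂.2.1 ((hmin K₂ hK₂).ssubset_of_ne hne)
  have hwM : ∀ C ∈ M, meanWidth C ∈ Icc (meanWidth K₁) (meanWidth K₂) := fun C hC =>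
    ⟨meanWidth_mono hn hb₁.2.1 hb₁.1 (hMb C hC).1.2.1 (hMb C hC).2.1,
      meanWidth_mono hn (hMb C hC).1.2.1 (hMb C hC).1.1 hb₂.2.1 (hMb C hC).2.2⟩
  have hΩeq : ∀ C ∈ M, Ω (meanWidth C) = C := fun C hC =>
    hinj _ (hΩM _ (hwM C hC)) C hC (hΩw _ (hwM C hC))
  have hmono : ∀ s ∈ Icc (meanWidth K₁) (meanWidth K₂), ∀ t ∈ Icc (meanWidth K₁) (meanWidth K₂),
      s ≤ t → Ω s ⊆ Ω t := fun s hs t ht hst =>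
    hsub _ (hΩM s hs) _ (hΩM t ht) (by rw [hΩw s hs, hΩw t ht]; exact hst)
  have hbody : ∀ t ∈ Icc (meanWidth K₁) (meanWidth K₂), IsBody (Ω t) := fun t ht =>
    (hMb _ (hΩM t ht)).1
  have hΩ₁ := hΩeq _ hM₁
  have hΩ₂ := hΩeq _ hM₂
  generalize meanWidth K₁ = a at *
  generalize meanWidth K₂ = b at *
  have hright : ∀ s ∈ Ico a b, ⋂ t ∈ Ioc s b, Ω t = Ω s := by
    intro s hs
    have hsI : s ∈ Icc a b := ⟨hs.1, hs.2.le⟩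
    have hcI : ∀ t ∈ Ioc s b, t ∈ Icc a b := fun t ht => ⟨hs.1.trans ht.1.le, ht.2⟩
    have hc : ∀ C ∈ Ω '' Ioc s b, IsBody C := by
      rintro _ ⟨t, ht, rfl⟩; exact hbody t (hcI t ht)
    have hcs : ∀ C ∈ Ω '' Ioc s b, Ω s ⊆ C := by
      rintro _ ⟨t, ht, rfl⟩; exact hmono s hsI t (hcI t ht) ht.1.le
    have hI := body_inter hc ⟨_, mem_image_of_mem _ ⟨hs.2, le_rfl⟩⟩ (hbody s hsI) hcs
    rw [← sInter_image]
    refine (body_eq hn (hbody s hsI) hI (subset_sInter hcs) ?_).symm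
    rw [hΩw s hsI]
    refine le_of_forall_gt_imp_ge_of_dense fun t ht => ?_
    by_cases htb : t ≤ b
    · rw [← hΩw t (hcI t ⟨ht, htb⟩)]
      exact meanWidth_mono hn hI.2.1 hI.1 (hbody t (hcI t ⟨ht, htb⟩)).2.1
        (sInter_subset_of_mem (mem_image_of_mem _ ⟨ht, htb⟩))
    · have hbI : b ∈ Icc a b := ⟨hlt.le, le_rfl⟩
      refine le_trans ?_ (not_le.1 htb).le
      conv_rhs => rw [← hΩw b hbI]
      exact meanWidth_mono hn hI.2.1 hI.1 (hbody b hbI).2.1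
        (sInter_subset_of_mem (mem_image_of_mem _ ⟨hs.2, le_rfl⟩))
  refine ⟨Ω, ⟨hbody, ?_, hright⟩, ?_, hΩw, hΩ₁, hΩ₂, fun Q hQ =>
    ⟨_, hwM Q (hFM hQ), hΩeq Q (hFM hQ)⟩⟩
  · intro s t has hst htb
    have hs : s ∈ Icc a b := ⟨has, hst.le.trans htb⟩
    have ht : t ∈ Icc a b := ⟨has.trans hst.le, htb⟩
    refine (hmono s hs t ht hst.le).ssubset_of_ne fun h => hst.ne ?_
    rw [← hΩw s hs, ← hΩw t ht, h]
  · rintro x ⟨hxb, hxa⟩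
    let T : Set ℝ := {t | t ∈ Icc a b ∧ x ∈ Ω t}
    have hbT : b ∈ T := ⟨⟨hlt.le, le_rfl⟩, hxb⟩
    have hTbdd : BddBelow T := ⟨a, fun t ht => ht.1.1⟩
    let t := sInf T
    have hat : a ≤ t := le_csInf ⟨b, hbT⟩ fun t ht => ht.1.1
    have htb : t ≤ b := csInf_le hTbdd hbT
    have htI : t ∈ Icc a b := ⟨hat, htb⟩
    have hup : ∀ r ∈ Ioc t b, x ∈ Ω r := by
      intro r hr
      obtain ⟨q, hq, hqr⟩ := exists_lt_of_csInf_lt ⟨b, hbT⟩ hr.1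
      exact hmono q hq.1 r ⟨hat.trans hr.1.le, hr.2⟩ hqr.le hq.2
    have hxt : x ∈ Ω t := by
      rcases htb.eq_or_lt with h | h
      · rw [h]; exact hxb
      · rw [← hright t ⟨hat, h⟩]
        exact mem_iInter₂.2 hup
    refine ⟨t, htI, ?_⟩
    have hcl : IsClosed (Ω t) := (hbody t htI).2.1.isClosed
    rw [← closure_sdiff_intrinsicInterior, hcl.closure_eq]
    refine ⟨hxt, fun hxi => ?_⟩
    rcases hat.eq_or_lt with h | h
    · rw [← h] at hxi; exact hxa hxi
    · have hcI : ∀ s ∈ Ico a t, s ∈ Icc a b := fun s hs => ⟨hs.1, hs.2.le.trans htb⟩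
      have hc : ∀ C ∈ Ω '' Ico a t, IsBody C := by
        rintro _ ⟨s, hs, rfl⟩; exact hbody s (hcI s hs)
      have hcs : ∀ C ∈ Ω '' Ico a t, C ⊆ Ω t := by
        rintro _ ⟨s, hs, rfl⟩; exact hmono s (hcI s hs) t htI hs.2.le
      have hcc : IsChain (· ⊆ ·) (Ω '' Ico a t) := by
        refine hMch.mono ?_
        rintro _ ⟨s, hs, rfl⟩; exact hΩM s (hcI s hs)
      have hne : (Ω '' Ico a t).Nonempty := ⟨_, mem_image_of_mem _ ⟨le_rfl, h⟩⟩
      have hU := body_union hc hcc hne (hbody t htI) hcs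
      have hUeq : closure (⋃₀ (Ω '' Ico a t)) = Ω t := by
        refine body_eq hn hU (hbody t htI) (closure_minimal (sUnion_subset hcs) hcl) ?_
        rw [hΩw t htI]
        refine le_of_forall_lt_imp_le_of_dense fun s hs => ?_
        have key : ∀ r ∈ Ico a t, r ≤ meanWidth (closure (⋃₀ (Ω '' Ico a t))) := by
          intro r hr
          conv_lhs => rw [← hΩw r (hcI r hr)]
          exact meanWidth_mono hn (hbody r (hcI r hr)).2.1 (hbody r (hcI r hr)).1 hU.2.1
            ((subset_sUnion_of_mem (mem_image_of_mem _ hr)).trans subset_closure)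
        exact (le_max_right a s).trans (key (max a s) ⟨le_max_left _ _, max_lt h hs⟩)
      rw [← hUeq] at hxi
      have hconv : Convex ℝ (⋃₀ (Ω '' Ico a t)) :=
        hcc.directedOn.convex_sUnion fun {C} hC => (hc C hC).2.2
      obtain ⟨_, ⟨s, hs, rfl⟩, hxs⟩ := mem_of_mem_intrinsicInterior_closure hconv
        (closure_nonempty_iff.1 hU.1) hxi
      exact hs.2.not_ge (csInf_le hTbdd ⟨hcI s hs, hxs⟩)

end
end

section
/- Let n ≥ 2 and p ≥ 1. Then for every constant c > 0 there exist nonempty compact convex sets K₁ ⊆ K₂ in ℝⁿ and a self-expanding curve x : [a,b] → ℝⁿ forming an expanding couple with {K₁, K₂} (image contained in K₂; the curve meets K₁ and the relative boundary of K₂; and for each Q ∈ {K₁,K₂}, every y ∈ Q and all s ≤ s', if x(s) ∉ relint Q then |x(s) − y| ≤ |x(s') − y|) such that the variation of x on {t : x(t) ∉ K₁} is strictly greater than c·(w(K₂) − w(K₁))^{1/p}. In other words, no constant independent of K₂ can make the bound length ≤ c·(w(K₂) − w(K₁))^{1/p} hold for all expanding couples. -/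
open Set Metric MeasureTheory
open scoped RealInnerProductSpace

noncomputable section

namespace PowerBound

open Filter Topology

/-- The outer body: a ball of radius `L` together with a point at distance `L + 1`. -/
def cap {n : ℕ} (e : EuclideanSpace ℝ (Fin n)) (L : ℝ) : Set (EuclideanSpace ℝ (Fin n)) :=
  closure (convexHull ℝ (closedBall 0 L ∪ {(L + 1) • e}))

variable {n : ℕ}

lemma intrinsicInterior_subset_interior {s : Set (EuclideanSpace ℝ (Fin n))}
    (h : affineSpan ℝ s = ⊤) : intrinsicInterior ℝ s ⊆ interior s := by
  have hr : IsOpen (Set.range ((↑) : affineSpan ℝ s → EuclideanSpace ℝ (Fin n))) := by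
    rw [Subtype.range_coe, h]
    simp
  have ho := (Topology.IsOpenEmbedding.mk Topology.IsEmbedding.subtypeVal hr).isOpenMap
  apply interior_maximal intrinsicInterior_subset
  exact ho _ isOpen_interior

lemma ball_subset_cap (e : EuclideanSpace ℝ (Fin n)) (L : ℝ) : closedBall 0 L ⊆ cap e L :=
  subset_union_left.trans ((subset_convexHull ℝ _).trans subset_closure)

lemma tip_mem_cap (e : EuclideanSpace ℝ (Fin n)) (L : ℝ) : (L + 1) • e ∈ cap e L :=
  subset_closure (subset_convexHull ℝ _ (Or.inr rfl))

lemma cap_subset {e : EuclideanSpace ℝ (Fin n)} {L : ℝ} {S : Set (EuclideanSpace ℝ (Fin n))}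
    (hS : Convex ℝ S) (hc : IsClosed S) (hb : closedBall 0 L ⊆ S) (ht : (L + 1) • e ∈ S) :
    cap e L ⊆ S :=
  closure_minimal (convexHull_min (union_subset hb (singleton_subset_iff.2 ht)) hS) hc

lemma convex_cap (e : EuclideanSpace ℝ (Fin n)) (L : ℝ) : Convex ℝ (cap e L) :=
  (convex_convexHull ℝ _).closure

lemma cap_subset_ball {e : EuclideanSpace ℝ (Fin n)} (he : ‖e‖ = 1) {L : ℝ} (hL : 0 ≤ L) :
    cap e L ⊆ closedBall 0 (L + 1) := by
  apply cap_subset (convex_closedBall _ _) isClosed_closedBall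
  · exact closedBall_subset_closedBall (by linarith)
  · rw [mem_closedBall_zero_iff, norm_smul, he, Real.norm_of_nonneg (by linarith), mul_one]

lemma isCompact_cap {e : EuclideanSpace ℝ (Fin n)} (he : ‖e‖ = 1) {L : ℝ} (hL : 0 ≤ L) :
    IsCompact (cap e L) :=
  (isCompact_closedBall _ _).of_isClosed_subset isClosed_closure (cap_subset_ball he hL)

lemma suppFn_ball {θ : EuclideanSpace ℝ (Fin n)} (hθ : ‖θ‖ = 1) {L : ℝ} (hL : 0 ≤ L) :
    suppFn (closedBall 0 L) θ = L := by
  apply IsGreatest.csSup_eq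
  constructor
  · refine ⟨L • θ, ?_, ?_⟩
    · rw [mem_closedBall_zero_iff, norm_smul, hθ, Real.norm_of_nonneg hL, mul_one]
    · simp [inner_smul_right, hθ]
  · rintro _ ⟨y, hy, rfl⟩
    rw [mem_closedBall_zero_iff] at hy
    have := real_inner_le_norm θ y
    rw [hθ, one_mul] at this
    exact this.trans hy

lemma suppFn_cap {e θ : EuclideanSpace ℝ (Fin n)} (hθ : ‖θ‖ = 1) {L : ℝ} (hL : 0 ≤ L) :
    suppFn (cap e L) θ = max L ((L + 1) * ⟪θ, e⟫) := by
  apply IsGreatest.csSup_eq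
  constructor
  · rcases le_total L ((L + 1) * ⟪θ, e⟫) with h | h
    · rw [max_eq_right h]
      exact ⟨_, tip_mem_cap e L, by simp [inner_smul_right]⟩
    · rw [max_eq_left h]
      refine ⟨L • θ, ball_subset_cap e L ?_, ?_⟩
      · rw [mem_closedBall_zero_iff, norm_smul, hθ, Real.norm_of_nonneg hL, mul_one]
      · simp [inner_smul_right, hθ]
  · rintro _ ⟨y, hy, rfl⟩
    have : cap e L ⊆ {y | ⟪θ, y⟫ ≤ max L ((L + 1) * ⟪θ, e⟫)} := by
      apply cap_subset
      · exact convex_halfSpace_le (innerₛₗ ℝ θ).isLinear _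
      · exact isClosed_le (by fun_prop) continuous_const
      · intro y hy
        rw [mem_closedBall_zero_iff] at hy
        have := real_inner_le_norm θ y
        rw [hθ, one_mul] at this
        exact (this.trans hy).trans (le_max_left _ _)
      · simp [inner_smul_right]
    exact this hy

lemma tendsto_width (hn : 2 ≤ n) {e : EuclideanSpace ℝ (Fin n)} (he : ‖e‖ = 1) :
    Tendsto (fun k : ℕ => meanWidth (cap e k) - meanWidth (closedBall 0 (k : ℝ) :
      Set (EuclideanSpace ℝ (Fin n)))) atTop (𝓝 0) := by
  by_cases hfin : sphereMeasure n (sphere (0 : EuclideanSpace ℝ (Fin n)) 1) = ⊤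
  · simp [meanWidth, sphereArea, hfin]
  set μ := (sphereMeasure n).restrict (sphere (0 : EuclideanSpace ℝ (Fin n)) 1) with hμ
  have : IsFiniteMeasure μ := ⟨by simpa [hμ, lt_top_iff_ne_top] using hfin⟩
  have hsph : ∀ᵐ θ ∂μ, ‖θ‖ = 1 := by
    filter_upwards [ae_restrict_mem (isClosed_sphere.measurableSet)] with θ hθ
    simpa using hθ
  have hne : ∀ᵐ θ ∂μ, θ ≠ e := by
    have : NullSingletonClass (sphereMeasure n) := by
      apply Measure.nullSingletonClass_hausdorff
      have : (2 : ℝ) ≤ n := by exact_mod_cast hn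
      linarith
    apply ae_restrict_of_ae
    exact Measure.ae_ne _ e
  have hle : ∀ θ : EuclideanSpace ℝ (Fin n), ‖θ‖ = 1 → ⟪θ, e⟫ ≤ 1 := by
    intro θ hθ
    simpa [hθ, he] using real_inner_le_norm θ e
  let F : ℕ → EuclideanSpace ℝ (Fin n) → ℝ := fun k θ => max (k : ℝ) ((k + 1) * ⟪θ, e⟫) - k
  have hFm : ∀ k, Continuous (F k) := fun k => by fun_prop
  have hFb : ∀ k θ, ‖θ‖ = 1 → ‖F k θ‖ ≤ 1 := by
    intro k θ hθ
    have hk : (0 : ℝ) ≤ k := k.cast_nonneg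
    have h0 : 0 ≤ F k θ := sub_nonneg.2 (le_max_left _ _)
    rw [Real.norm_of_nonneg h0]
    have := hle θ hθ
    apply sub_le_iff_le_add.2
    apply max_le (by linarith)
    nlinarith
  have hFi : ∀ k, Integrable (F k) μ := by
    intro k
    refine Integrable.of_bound (hFm k).aestronglyMeasurable 1 ?_
    filter_upwards [hsph] with θ hθ using hFb k θ hθ
  have hlim : Tendsto (fun k => ∫ θ, F k θ ∂μ) atTop (𝓝 (∫ θ, (0 : ℝ) ∂μ)) := by
    apply tendsto_integral_of_dominated_convergence (fun _ => (1 : ℝ))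
    · exact fun k => (hFm k).aestronglyMeasurable
    · exact integrable_const _
    · intro k
      filter_upwards [hsph] with θ hθ using hFb k θ hθ
    · filter_upwards [hsph, hne] with θ hθ hne
      have hlt : ⟪θ, e⟫ < 1 := by
        refine lt_of_le_of_ne (hle θ hθ) fun h => hne ?_
        exact (inner_eq_one_iff_of_norm_eq_one hθ he).1 h
      apply tendsto_const_nhds.congr'
      obtain ⟨N, hN⟩ := exists_nat_ge (⟪θ, e⟫ / (1 - ⟪θ, e⟫))
      filter_upwards [eventually_ge_atTop N] with k hk
      have hk' : (N : ℝ) ≤ k := by exact_mod_cast hk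
      have h1 : ⟪θ, e⟫ ≤ k * (1 - ⟪θ, e⟫) := (div_le_iff₀ (by linarith)).1 (hN.trans hk')
      have : max (k : ℝ) ((k + 1) * ⟪θ, e⟫) = k := max_eq_left (by nlinarith)
      simp [F, this]
  have hkey : ∀ k : ℕ, meanWidth (cap e k) - meanWidth (closedBall 0 (k : ℝ) :
      Set (EuclideanSpace ℝ (Fin n))) = (2 / sphereArea n) * ∫ θ, F k θ ∂μ := by
    intro k
    have h1 : ∫ θ, suppFn (cap e k) θ ∂μ = ∫ θ, (F k θ + k) ∂μ := by
      apply integral_congr_ae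
      filter_upwards [hsph] with θ hθ
      rw [suppFn_cap hθ k.cast_nonneg]
      simp [F]
    have h2 : ∫ θ, suppFn (closedBall 0 (k : ℝ)) θ ∂μ = ∫ θ, (k : ℝ) ∂μ := by
      apply integral_congr_ae
      filter_upwards [hsph] with θ hθ
      rw [suppFn_ball hθ k.cast_nonneg]
    unfold meanWidth
    rw [← hμ, h1, h2, integral_add (hFi k) (integrable_const _)]
    ring
  simp_rw [hkey]
  simpa using hlim.const_mul (2 / sphereArea n)

end PowerBound

open PowerBound in
/-- no uniform bound `c · (w(K₂) − w(K₁))^{1/p}` for the length of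
expanding couples. -/
theorem expandingCouple_no_uniform_power_bound (n : ℕ) (hn : 2 ≤ n)
    (p : ℝ) (hp : 1 ≤ p) (c : ℝ) (hc : 0 < c) :
    ∃ (K₁ K₂ : Set (EuclideanSpace ℝ (Fin n))) (a b : ℝ)
      (x : ℝ → EuclideanSpace ℝ (Fin n)),
      K₁.Nonempty ∧ IsCompact K₁ ∧ Convex ℝ K₁ ∧
      K₂.Nonempty ∧ IsCompact K₂ ∧ Convex ℝ K₂ ∧ K₁ ⊆ K₂ ∧
      SelfExpanding a b x ∧
      (∀ t ∈ Icc a b, x t ∈ K₂) ∧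
      (∃ s ∈ Icc a b, x s ∈ K₁) ∧
      (∃ s ∈ Icc a b, x s ∈ intrinsicFrontier ℝ K₂) ∧
      (∀ Q ∈ ({K₁, K₂} : Set (Set (EuclideanSpace ℝ (Fin n)))), ∀ y ∈ Q,
        ∀ s s', a ≤ s → s ≤ s' → s' ≤ b → x s ∉ intrinsicInterior ℝ Q →
          dist (x s) y ≤ dist (x s') y) ∧
      ENNReal.ofReal (c * (meanWidth K₂ - meanWidth K₁) ^ ((1 : ℝ) / p)) <
        eVariationOn x {t | t ∈ Icc a b ∧ x t ∉ K₁} := by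
  let e : EuclideanSpace ℝ (Fin n) := EuclideanSpace.single ⟨0, by omega⟩ 1
  have he : ‖e‖ = 1 := by simp [e]
  have hp0 : 0 < 1 / p := by positivity
  have hlim : Filter.Tendsto (fun k : ℕ => c * (meanWidth (cap e k) -
      meanWidth (closedBall 0 (k : ℝ) : Set (EuclideanSpace ℝ (Fin n)))) ^ ((1 : ℝ) / p))
      Filter.atTop (nhds 0) := by
    have := ((tendsto_width hn he).rpow_const (Or.inr hp0.le)).const_mul c
    rwa [Real.zero_rpow hp0.ne', mul_zero] at this
  obtain ⟨k, hk1, hk⟩ := ((Filter.eventually_ge_atTop 1).and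
    (hlim.eventually (gt_mem_nhds (show (0 : ℝ) < 1 / 2 by norm_num)))).exists
  have hL1 : (1 : ℝ) ≤ k := by exact_mod_cast hk1
  have hL : (0 : ℝ) < k := by linarith
  generalize (k : ℝ) = L at hk hL hL1
  have hxn : ∀ t : ℝ, 0 ≤ t → ‖(L + t) • e‖ = L + t := by
    intro t ht
    rw [norm_smul, he, Real.norm_of_nonneg (by linarith), mul_one]
  have hdist : ∀ s t : ℝ, dist ((L + s) • e) ((L + t) • e) = |s - t| := by
    intro s t
    rw [dist_eq_norm, ← sub_smul, norm_smul, he, mul_one, Real.norm_eq_abs]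
    congr 1
    ring
  have h0int : (0 : EuclideanSpace ℝ (Fin n)) ∈ interior (cap e L) :=
    interior_mono (ball_subset_cap e L)
      (ball_subset_interior_closedBall (mem_ball_self hL))
  have hint : ∀ s : ℝ, 0 ≤ s → s < 1 → (L + s) • e ∈ interior (cap e L) := by
    intro s hs0 hs1
    apply (convex_cap e L).openSegment_interior_self_subset_interior h0int (tip_mem_cap e L)
    refine ⟨1 - (L + s) / (L + 1), (L + s) / (L + 1), ?_, by positivity, by ring, ?_⟩
    · rw [sub_pos, div_lt_one (by linarith)]
      linarith
    · rw [smul_zero, zero_add, smul_smul, div_mul_cancel₀ _ (by linarith)]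
  refine ⟨closedBall 0 L, cap e L, 0, 1, fun t => (L + t) • e, ⟨0, by simp [hL.le]⟩,
    isCompact_closedBall _ _, convex_closedBall _ _, ⟨_, tip_mem_cap e L⟩,
    isCompact_cap he hL.le, convex_cap e L, ball_subset_cap e L, ⟨?_, ?_⟩, ?_, ⟨0, by simp, ?_⟩,
    ⟨1, by simp, ?_⟩, ?_, ?_⟩
  · exact Continuous.continuousOn (by fun_prop)
  · intro t₁ t₂ t₃ _ h12 h23 _
    simp only [hdist]
    rw [abs_of_nonneg (by linarith), abs_of_nonneg (by linarith)]
    linarith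
  · intro t ht
    rcases ht.2.lt_or_eq with h | rfl
    · exact interior_subset (hint t ht.1 h)
    · exact tip_mem_cap e L
  · simpa using (hxn 0 le_rfl).le
  · rw [← intrinsicClosure_sdiff_intrinsicInterior]
    refine ⟨subset_intrinsicClosure (tip_mem_cap e L), fun h => ?_⟩
    have h1 := intrinsicInterior_subset_interior
      (affineSpan_eq_top_of_nonempty_interior
        ⟨0, interior_mono (subset_convexHull ℝ _) h0int⟩) h
    have h2 := interior_mono (cap_subset_ball he hL.le) h1
    rw [interior_closedBall _ (by linarith), mem_ball_zero_iff, hxn 1 zero_le_one] at h2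
    exact lt_irrefl _ h2
  · intro Q hQ y hy s s' hs hss hs' hx
    rcases hQ with rfl | rfl
    · rw [mem_closedBall_zero_iff] at hy
      have h1 := real_inner_le_norm e y
      rw [he, one_mul] at h1
      rw [dist_eq_norm, dist_eq_norm]
      apply le_of_sq_le_sq _ (norm_nonneg _)
      rw [norm_sub_sq_real, norm_sub_sq_real, hxn s hs, hxn s' (hs.trans hss),
        real_inner_smul_left, real_inner_smul_left]
      nlinarith [mul_nonneg (sub_nonneg.2 hss) (sub_nonneg.2 (h1.trans hy)),
        mul_nonneg (sub_nonneg.2 hss) hs, mul_nonneg (sub_nonneg.2 hss) (hs.trans hss)]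
    · rcases (hss.trans hs').lt_or_eq with h | h
      · exact absurd (interior_subset_intrinsicInterior (hint s hs h)) hx
      · have : s' = s := by linarith
        rw [this]
  · have hmem : ∀ t : ℝ, 0 < t → t ≤ 1 →
        t ∈ {t : ℝ | t ∈ Icc (0 : ℝ) 1 ∧ (L + t) • e ∉ closedBall (0 : EuclideanSpace ℝ (Fin n)) L} := by
      intro t h0 h1
      refine ⟨⟨h0.le, h1⟩, ?_⟩
      rw [mem_closedBall_zero_iff, hxn t h0.le]
      linarith
    refine lt_of_lt_of_le ?_ (eVariationOn.edist_le _ (hmem 1 one_pos le_rfl)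
      (hmem (1 / 2) (by norm_num) (by norm_num)))
    rw [edist_dist, hdist]
    apply (ENNReal.ofReal_lt_ofReal_iff (by norm_num)).2
    norm_num at hk ⊢
    exact hk

end
end

section
/- Let Q be a nonempty compact convex subset of ℝⁿ and let x : [a,b] → ℝⁿ be a continuous injective self-expanding curve satisfying the expanding-couple condition with respect to Q: for every y ∈ Q and all s ≤ s' in [a,b], if x(s) ∉ relint Q then |x(s) − y| ≤ |x(s') − y|. Then the image of x meets the relative (intrinsic) boundary of Q in at most one point. -/
open Set Metric MeasureTheory
open scoped RealInnerProductSpace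

noncomputable section

/-- an expanding curve meets the relative boundary of a member of the
stratification in at most one point. -/
theorem expandingCouple_meets_relBoundary_subsingleton {n : ℕ}
    (Q : Set (EuclideanSpace ℝ (Fin n)))
    (hQne : Q.Nonempty) (hQc : IsCompact Q) (hQv : Convex ℝ Q)
    {a b : ℝ} {x : ℝ → EuclideanSpace ℝ (Fin n)}
    (hx : SelfExpanding a b x) (hinj : Set.InjOn x (Icc a b))
    (hEC : ∀ y ∈ Q, ∀ s s', a ≤ s → s ≤ s' → s' ≤ b → x s ∉ intrinsicInterior ℝ Q →
      dist (x s) y ≤ dist (x s') y) :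
    (x '' Icc a b ∩ intrinsicFrontier ℝ Q).Subsingleton := by
  have hcl : intrinsicFrontier ℝ Q ⊆ Q := intrinsicFrontier_subset hQc.isClosed
  have hni : ∀ p ∈ intrinsicFrontier ℝ Q, p ∉ intrinsicInterior ℝ Q := by
    intro p hp hp'
    rw [← intrinsicClosure_diff_intrinsicInterior] at hp
    exact hp.2 hp'
  rintro _ ⟨⟨s, hs, rfl⟩, hsF⟩ _ ⟨⟨t, ht, rfl⟩, htF⟩
  rcases le_total s t with h | h
  · have h1 := hEC (x t) (hcl htF) s t hs.1 h ht.2 (hni _ hsF)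
    rw [dist_self] at h1
    exact dist_le_zero.mp h1
  · have h1 := hEC (x s) (hcl hsF) t s ht.1 h hs.2 (hni _ htF)
    rw [dist_self] at h1
    exact (dist_le_zero.mp h1).symm

end
end

section
/- Let {Ω_t}_{t ∈ [a,b]} be a connected quasi convex family in ℝⁿ. Let x, y : [a,b] → ℝⁿ be two absolutely continuous viable steepest descent curves for the family, i.e. there exist integrable functions f, g : [a,b] → ℝⁿ with x(t) = x(a) + ∫_a^t f(s) ds and y(t) = y(a) + ∫_a^t g(s) ds, x(t) and y(t) lie in the relative (intrinsic) boundary of Ω_t for every t ∈ (a,b], and for almost every t ∈ [a,b], f(t) ∈ N_{Ω_t}(x(t)) and g(t) ∈ N_{Ω_t}(y(t)). Then |x(t) − y(t)| ≤ |x(b) − y(b)| for all t ∈ [a,b]; in particular, if x(b) = y(b) then x = y, so an absolutely continuous viable steepest descent curve with a given end point is unique. -/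
open Set Metric MeasureTheory
open scoped RealInnerProductSpace

noncomputable section

lemma ac_normSq_aux {n : ℕ} {a b : ℝ} (c : EuclideanSpace ℝ (Fin n))
    {w : ℝ → EuclideanSpace ℝ (Fin n)} (hw : IntervalIntegrable w volume a b) :
    AbsolutelyContinuousOnInterval (fun t => ‖c + ∫ s in a..t, w s‖ ^ 2) a b := by
  have hcoord : ∀ i : Fin n,
      AbsolutelyContinuousOnInterval (fun t => c i + ∫ s in a..t, w s i) a b := by
    intro i
    have hwi : IntervalIntegrable (fun s => w s i) volume a b := by
      exact ⟨(EuclideanSpace.proj i : EuclideanSpace ℝ (Fin n) →L[ℝ] ℝ).integrable_comp hw.1,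
        (EuclideanSpace.proj i : EuclideanSpace ℝ (Fin n) →L[ℝ] ℝ).integrable_comp hw.2⟩
    have hconst : AbsolutelyContinuousOnInterval (fun _ : ℝ => c i) a b :=
      (contDiff_const (𝕜 := ℝ) (n := 1)).contDiffOn.absolutelyContinuousOnInterval
    exact hconst.fun_add
      (hwi.absolutelyContinuousOnInterval_intervalIntegral (c := a) (by simp))
  have hsum : ∀ S : Finset (Fin n), AbsolutelyContinuousOnInterval
      (fun t => ∑ i ∈ S, (c i + ∫ s in a..t, w s i) * (c i + ∫ s in a..t, w s i)) a b := by
    intro S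
    induction S using Finset.induction_on with
    | empty =>
      simpa using
        (contDiff_const (𝕜 := ℝ) (n := 1) (c := (0 : ℝ))).contDiffOn.absolutelyContinuousOnInterval
    | insert i S hi ih =>
      simp only [Finset.sum_insert hi]
      exact ((hcoord i).fun_mul (hcoord i)).fun_add ih
  have hac := (hsum Finset.univ)
  have hEq : ∀ t ∈ uIcc a b, ‖c + ∫ s in a..t, w s‖ ^ 2 =
      ∑ i, (c i + ∫ s in a..t, w s i) * (c i + ∫ s in a..t, w s i) := by
    intro t ht
    have hwt : IntervalIntegrable w volume a t :=
      hw.mono_set (uIcc_subset_uIcc left_mem_uIcc ht)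
    rw [EuclideanSpace.norm_sq_eq]
    refine Finset.sum_congr rfl fun i _ => ?_
    have h := (EuclideanSpace.proj i : EuclideanSpace ℝ (Fin n) →L[ℝ] ℝ).intervalIntegral_comp_comm hwt
    change (∫ s in a..t, w s i) = (∫ s in a..t, w s) i at h
    rw [h, Real.norm_eq_abs, sq_abs, PiLp.add_apply, sq]
  rw [absolutelyContinuousOnInterval_iff] at hac ⊢
  intro ε hε
  obtain ⟨δ, hδ, H⟩ := hac ε hε
  refine ⟨δ, hδ, fun E hE hl => ?_⟩
  refine lt_of_eq_of_lt (Finset.sum_congr rfl fun i hi => ?_) (H E hE hl)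
  have := hE.1 i hi
  rw [hEq _ this.1, hEq _ this.2]

/-- stability and uniqueness of absolutely continuous viable steepest
descent curves. -/
theorem viable_steepest_descent_stability {n : ℕ} {a b : ℝ} (hab : a < b)
    {Ω : ℝ → Set (EuclideanSpace ℝ (Fin n))}
    (hΩ : QuasiConvexFamily a b Ω) (hconn : ConnectedFamily a b Ω)
    (x y : ℝ → EuclideanSpace ℝ (Fin n)) (f g : ℝ → EuclideanSpace ℝ (Fin n))
    (hf : IntervalIntegrable f MeasureTheory.volume a b)
    (hg : IntervalIntegrable g MeasureTheory.volume a b)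
    (hx : ∀ t ∈ Icc a b, x t = x a + ∫ s in a..t, f s)
    (hy : ∀ t ∈ Icc a b, y t = y a + ∫ s in a..t, g s)
    (hxfr : ∀ t ∈ Ioc a b, x t ∈ intrinsicFrontier ℝ (Ω t))
    (hyfr : ∀ t ∈ Ioc a b, y t ∈ intrinsicFrontier ℝ (Ω t))
    (hxd : ∀ᵐ t ∂(MeasureTheory.volume.restrict (Icc a b)), f t ∈ normalCone (Ω t) (x t))
    (hyd : ∀ᵐ t ∂(MeasureTheory.volume.restrict (Icc a b)), g t ∈ normalCone (Ω t) (y t)) :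
    (∀ t ∈ Icc a b, dist (x t) (y t) ≤ dist (x b) (y b)) ∧
    (x b = y b → ∀ t ∈ Icc a b, x t = y t) := by
  obtain ⟨hprop, -, -⟩ := hΩ
  have hw : IntervalIntegrable (fun s => f s - g s) volume a b := hf.sub hg
  have hle := hab.le
  have hZ : ∀ t ∈ Icc a b, x t - y t = (x a - y a) + ∫ s in a..t, (f s - g s) := by
    intro t ht
    have hsub : uIcc a t ⊆ uIcc a b := by
      rw [uIcc_of_le ht.1, uIcc_of_le hle]; exact Icc_subset_Icc_right ht.2
    rw [intervalIntegral.integral_sub (hf.mono_set hsub) (hg.mono_set hsub),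
      hx t ht, hy t ht]
    abel
  have hmem : ∀ (z : ℝ → EuclideanSpace ℝ (Fin n)),
      (∀ t ∈ Ioc a b, z t ∈ intrinsicFrontier ℝ (Ω t)) → ∀ t ∈ Ioc a b, z t ∈ Ω t := by
    intro z hz t ht
    exact intrinsicFrontier_subset (hprop t (Ioc_subset_Icc_self ht)).2.1.isClosed (hz t ht)
  have hac := ac_normSq_aux (x a - y a) hw
  have main : ∀ t ∈ Icc a b, dist (x t) (y t) ≤ dist (x b) (y b) := by
    intro t ht
    have hact := hac.mono (c := t) (d := b) (by
      rw [uIcc_of_le ht.2, uIcc_of_le hle]; exact Icc_subset_Icc_left ht.1)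
    have hint := hact.integral_deriv_eq_sub
    have hnonneg : 0 ≤ ∫ s in t..b,
        deriv (fun t => ‖(x a - y a) + ∫ s in a..t, (f s - g s)‖ ^ 2) s := by
      apply intervalIntegral.integral_nonneg_of_ae_restrict ht.2
      rw [Filter.EventuallyLE, ae_restrict_iff' measurableSet_Icc]
      rw [ae_restrict_iff' measurableSet_Icc] at hxd hyd
      have hne : ∀ᵐ s : ℝ, s ≠ a := by simp [ae_iff, measure_singleton]
      filter_upwards [hxd, hyd, hw.ae_hasDerivAt_integral, hne] with s h1 h2 h3 h4 hs
      have hsI : s ∈ Icc a b := ⟨ht.1.trans hs.1, hs.2⟩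
      have hsO : s ∈ Ioc a b := ⟨lt_of_le_of_ne hsI.1 (Ne.symm h4), hsI.2⟩
      have hd := ((h3 (by rwa [uIcc_of_le hle]) a (by simp)).const_add (x a - y a)).norm_sq
      rw [hd.deriv, ← hZ s hsI]
      have e1 := h1 hsI (y s) (hmem y hyfr s hsO)
      have e2 := h2 hsI (x s) (hmem x hxfr s hsO)
      have e3 : ⟪x s - y s, f s - g s⟫ = - ⟪f s, y s - x s⟫ - ⟪g s, x s - y s⟫ := by
        rw [real_inner_comm, inner_sub_left, ← inner_neg_right, neg_sub]
      simp only [Pi.zero_apply]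
      rw [e3]
      linarith
    rw [hint, ← hZ t ht, ← hZ b (right_mem_Icc.2 hle)] at hnonneg
    rw [dist_eq_norm, dist_eq_norm]
    exact (sq_le_sq₀ (norm_nonneg _) (norm_nonneg _)).1 (by linarith)
  refine ⟨main, fun hb t ht => ?_⟩
  have := main t ht
  rw [hb, dist_self] at this
  exact dist_le_zero.1 this

end
end
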